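/- Let A be a finite-dimensional k-algebra and let M be an A-module with a filtration 0 = M_0 ⊆ M_1 ⊆ ... ⊆ M_n = M whose successive quotients M_i/M_{i-1} belong to a set {Θ_λ} of modules satisfying Ext^1_A(Θ_λ, Θ_μ) = 0 whenever h(λ) ≥ h(μ) for a height function h on the index poset. Then M admits a filtration in which the factors appear in order of increasing height: there is a submodule M' ⊆ M filtered by the factors Θ_λ of non-minimal height such that M/M' is a direct sum of the factors Θ_λ of minimal height occurring in the filtration. -/

import Mathlib

open CategoryTheory

/-- `ext A n M N` is the Ext group `Ext^n_A(M, N)` in the category of left `A`-modules. -/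
noncomputable abbrev ext (A : Type) [Ring A] (n : ℕ) (M N : ModuleCat A) : Type :=
  ((Ext ℤ (ModuleCat A) n).obj (Opposite.op M)).obj N

/-- `M` has a filtration `0 = F 0 ⊆ ... ⊆ F n = M` whose successive quotients are
isomorphic to modules `Θ (lam i)` with all indices `lam i` satisfying `Pred`. -/
def HasFiltrationBy (A : Type) [Ring A] {Λ : Type} (Θ : Λ → Type)
    [∀ lam, AddCommGroup (Θ lam)] [∀ lam, Module A (Θ lam)]
    (M : Type) [AddCommGroup M] [Module A M] (Pred : Λ → Prop) : Prop :=
  ∃ (n : ℕ) (F : Fin (n + 1) → Submodule A M) (lam : Fin n → Λ),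
    Monotone F ∧ F 0 = ⊥ ∧ F (Fin.last n) = ⊤ ∧
    ∀ i : Fin n, Pred (lam i) ∧
      Nonempty ((↥(F i.succ) ⧸ (Submodule.comap (F i.succ).subtype (F i.castSucc)))
        ≃ₗ[A] Θ (lam i))


open CategoryTheory in
lemma fr_cocycle {A : Type} [Ring A] (X Y : ModuleCat A) (P : ProjectiveResolution X)
    (hs : Subsingleton (ext A 1 X Y)) (f : P.complex.X 1 ⟶ Y)
    (hf : P.complex.d 2 1 ≫ f = 0) : ∃ g : P.complex.X 0 ⟶ Y, P.complex.d 1 0 ≫ g = f := by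
  have hz : Limits.IsZero ((P.complex.linearYonedaObj ℤ Y).homology 1) :=
    Limits.IsZero.of_iso (ModuleCat.isZero_of_subsingleton _) (P.isoExt (R := ℤ) 1 Y).symm
  rw [← HomologicalComplex.exactAt_iff_isZero_homology,
    HomologicalComplex.exactAt_iff' _ 0 1 2 (by simp) (by simp),
    ShortComplex.moduleCat_exact_iff] at hz
  obtain ⟨g, hg⟩ := hz f hf
  exact ⟨g, hg⟩

lemma fr_desc {A B C D : Type} [Ring A] [AddCommGroup B] [AddCommGroup C] [AddCommGroup D]
    [Module A B] [Module A C] [Module A D] (f : B →ₗ[A] C) (hf : Function.Surjective f)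
    (g : B →ₗ[A] D) (hg : ∀ b, f b = 0 → g b = 0) : ∃ r : C →ₗ[A] D, ∀ b, r (f b) = g b := by
  refine ⟨(LinearMap.ker f).liftQ g (fun b hb => hg b hb) ∘ₗ
    (f.quotKerEquivOfSurjective hf).symm.toLinearMap, fun b => ?_⟩
  have : (f.quotKerEquivOfSurjective hf).symm (f b) = Submodule.Quotient.mk b := by
    rw [LinearEquiv.symm_apply_eq]; rfl
  rw [LinearMap.comp_apply, LinearEquiv.coe_coe, this]
  exact Submodule.liftQ_apply _ _ _

open CategoryTheory in
lemma fr_extend {A : Type} [Ring A] {N T X Y : Type} [AddCommGroup N] [AddCommGroup T]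
    [AddCommGroup X] [AddCommGroup Y] [Module A N] [Module A T] [Module A X] [Module A Y]
    (hs : Subsingleton (ext A 1 (ModuleCat.of A X) (ModuleCat.of A Y)))
    (i : N →ₗ[A] T) (hi : Function.Injective i) (p : T →ₗ[A] X) (hp : Function.Surjective p)
    (hip : ∀ t, p t = 0 ↔ ∃ n, i n = t) (q : N →ₗ[A] Y) :
    ∃ r : T →ₗ[A] Y, ∀ n, r (i n) = q n := by
  obtain ⟨P⟩ := (inferInstance : HasProjectiveResolution (ModuleCat.of A X)).out
  have := P.projective 0
  let π : P.complex.X 0 ⟶ ModuleCat.of A X := P.π.f 0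
  have hepi : Epi (ModuleCat.ofHom p) := (ModuleCat.epi_iff_surjective _).2 hp
  let φ : P.complex.X 0 ⟶ ModuleCat.of A T := Projective.factorThru π (ModuleCat.ofHom p)
  have hφ : φ ≫ ModuleCat.ofHom p = π := Projective.factorThru_comp _ _
  have hφ' : ∀ u, p (φ u) = π u := fun u => congr($hφ u)
  have hdπ : P.complex.d 1 0 ≫ π = 0 := P.complex_d_comp_π_f_zero
  have hdπ' : ∀ u, π (P.complex.d 1 0 u) = 0 := fun u => congr($hdπ u)
  have hex : ∀ u, π u = 0 → ∃ v, P.complex.d 1 0 v = u := by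
    have := P.exact₀
    rw [ShortComplex.moduleCat_exact_iff] at this
    exact this
  let e := LinearEquiv.ofInjective i hi
  let ψ : P.complex.X 1 →ₗ[A] N := e.symm.toLinearMap ∘ₗ
    LinearMap.codRestrict (LinearMap.range i) (φ.hom ∘ₗ (P.complex.d 1 0).hom)
      (fun v => (hip _).1 (by
        change p (φ (P.complex.d 1 0 v)) = 0
        rw [hφ', hdπ']))
  have hψ : ∀ v, i (ψ v) = φ (P.complex.d 1 0 v) := by
    intro v
    have : ∀ y : LinearMap.range i, i (e.symm y) = y := fun y =>
      congrArg Subtype.val (e.apply_symm_apply y)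
    exact this _
  obtain ⟨g, hg⟩ := fr_cocycle _ _ P hs (ModuleCat.ofHom (q ∘ₗ ψ)) (by
    ext v
    change q (ψ (P.complex.d 2 1 v)) = 0
    have : ψ (P.complex.d 2 1 v) = 0 := by
      apply hi
      rw [hψ, map_zero]
      have h2 : P.complex.d 2 1 ≫ P.complex.d 1 0 = 0 := P.complex.d_comp_d _ _ _
      have h3 : P.complex.d 1 0 (P.complex.d 2 1 v) = 0 := congr($h2 v)
      rw [h3, map_zero]
    rw [this, map_zero])
  have hg' : ∀ v, g (P.complex.d 1 0 v) = q (ψ v) := fun v => congr($hg v)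
  obtain ⟨r, hr⟩ := fr_desc (LinearMap.coprod i φ.hom) (by
    intro t
    have : Function.Surjective π :=
      (ModuleCat.epi_iff_surjective _).1 (inferInstance : Epi (P.π.f 0))
    obtain ⟨u, hu⟩ := this (p t)
    obtain ⟨n, hn⟩ := (hip (t - φ u)).1 (by rw [map_sub, hφ', hu, sub_self])
    exact ⟨(n, u), by simp [hn]⟩) (LinearMap.coprod q g.hom) (by
    rintro ⟨n, u⟩ h
    simp only [LinearMap.coprod_apply] at h ⊢
    have h1 : π u = 0 := by
      rw [← hφ', ← map_zero p, ← h, map_add, (hip (i n)).2 ⟨n, rfl⟩, zero_add]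
    obtain ⟨v, rfl⟩ := hex u h1
    have h2 : n + ψ v = 0 := hi (by rw [map_add, hψ, map_zero]; exact h)
    have h3 := hg' v
    change q n + g (P.complex.d 1 0 v) = 0
    rw [h3, ← map_add, h2, map_zero])
  exact ⟨r, fun n => by simpa using hr (n, 0)⟩

def FrFac {A : Type} [Ring A] {M : Type} [AddCommGroup M] [Module A M] (N N' : Submodule A M)
    (X : Type) [AddCommGroup X] [Module A X] : Prop :=
  ∃ f : N' →ₗ[A] X, Function.Surjective f ∧ ∀ x, f x = 0 ↔ x.1 ∈ N

lemma frFac_iff {A : Type} [Ring A] {M : Type} [AddCommGroup M] [Module A M]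
    (N N' : Submodule A M) (X : Type) [AddCommGroup X] [Module A X] :
    FrFac N N' X ↔ Nonempty ((↥N' ⧸ (Submodule.comap N'.subtype N)) ≃ₗ[A] X) := by
  constructor
  · rintro ⟨f, hf, hk⟩
    have : Submodule.comap N'.subtype N = LinearMap.ker f := by
      ext x; simp [hk]
    rw [this]
    exact ⟨f.quotKerEquivOfSurjective hf⟩
  · rintro ⟨e⟩
    refine ⟨e.toLinearMap ∘ₗ Submodule.mkQ _, e.surjective.comp (Submodule.mkQ_surjective _), ?_⟩
    intro x
    simp

inductive FrFilt {A : Type} [Ring A] {Λ : Type} (Θ : Λ → Type)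
    [∀ lam, AddCommGroup (Θ lam)] [∀ lam, Module A (Θ lam)]
    {M : Type} [AddCommGroup M] [Module A M] (Pred : Λ → Prop) : Submodule A M → Prop
  | bot : FrFilt Θ Pred ⊥
  | step (N N' : Submodule A M) (nu : Λ) : N ≤ N' → FrFilt Θ Pred N → Pred nu →
      FrFac N N' (Θ nu) → FrFilt Θ Pred N'

lemma frFilt_exists {A : Type} [Ring A] {Λ : Type} (Θ : Λ → Type)
    [∀ lam, AddCommGroup (Θ lam)] [∀ lam, Module A (Θ lam)]
    {M : Type} [AddCommGroup M] [Module A M] (Pred : Λ → Prop) (N : Submodule A M)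
    (hN : FrFilt Θ Pred N) :
    ∃ (n : ℕ) (F : Fin (n + 1) → Submodule A M) (lam : Fin n → Λ),
      Monotone F ∧ F 0 = ⊥ ∧ F (Fin.last n) = N ∧
      ∀ i : Fin n, Pred (lam i) ∧ FrFac (F i.castSucc) (F i.succ) (Θ (lam i)) := by
  induction hN with
  | bot => exact ⟨0, fun _ => ⊥, Fin.elim0, monotone_const, rfl, rfl, fun i => i.elim0⟩
  | step N N' nu hle _ hnu hfac ih =>
    obtain ⟨n, F, lam, hmono, h0, hlast, hF⟩ := ih
    refine ⟨n + 1, Fin.snoc (α := fun _ => Submodule A M) F N', Fin.snoc (α := fun _ => Λ) lam nu,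
      ?_, ?_, ?_, ?_⟩
    · rw [Fin.monotone_iff_le_succ]
      intro i
      induction i using Fin.lastCases with
      | last => simp [hlast, hle]
      | cast i =>
        rw [Fin.succ_castSucc, Fin.snoc_castSucc, Fin.snoc_castSucc]
        exact hmono (Fin.castSucc_le_succ i)
    · rw [← Fin.castSucc_zero, Fin.snoc_castSucc, h0]
    · simp
    · intro i
      induction i using Fin.lastCases with
      | last =>
        rw [Fin.succ_last, Fin.snoc_last, Fin.snoc_last, Fin.snoc_castSucc, hlast]
        exact ⟨hnu, hfac⟩
      | cast i =>
        rw [Fin.succ_castSucc, Fin.snoc_castSucc, Fin.snoc_castSucc, Fin.snoc_castSucc]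
        exact hF i

lemma frFilt_has {A : Type} [Ring A] {Λ : Type} (Θ : Λ → Type)
    [∀ lam, AddCommGroup (Θ lam)] [∀ lam, Module A (Θ lam)]
    {M : Type} [AddCommGroup M] [Module A M] (Pred : Λ → Prop) (N : Submodule A M)
    (hN : FrFilt Θ Pred N) : HasFiltrationBy A Θ ↥N Pred := by
  obtain ⟨n, F, lam, hmono, h0, hlast, hF⟩ := frFilt_exists Θ Pred N hN
  have hle : ∀ i, F i ≤ N := fun i => hlast ▸ hmono (Fin.le_last i)
  refine ⟨n, fun i => (F i).comap N.subtype, lam, fun i j hij => Submodule.comap_mono (hmono hij),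
    ?_, ?_, ?_⟩
  · simp [h0]
  · simp [hlast]
  · intro i
    refine ⟨(hF i).1, ?_⟩
    rw [← frFac_iff]
    obtain ⟨f, hf, hk⟩ := (hF i).2
    refine ⟨f ∘ₗ (Submodule.comapSubtypeEquivOfLe (hle i.succ)).toLinearMap,
      hf.comp (LinearEquiv.surjective _), ?_⟩
    intro x
    simp only [LinearMap.comp_apply, hk]
    rfl

lemma fr_main {A : Type} [Ring A] {Λ : Type} (h : Λ → ℕ)
    (Θ : Λ → Type) [∀ lam, AddCommGroup (Θ lam)] [∀ lam, Module A (Θ lam)]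
    (hext : ∀ lam mu : Λ, h mu ≤ h lam →
      Subsingleton (ext A 1 (ModuleCat.of A (Θ lam)) (ModuleCat.of A (Θ mu))))
    (M : Type) [AddCommGroup M] [Module A M]
    (n : ℕ) (F : Fin (n + 1) → Submodule A M) (lam : Fin n → Λ)
    (hmono : Monotone F) (hbot : F 0 = ⊥)
    (hfac : ∀ i : Fin n, FrFac (F i.castSucc) (F i.succ) (Θ (lam i)))
    (m : ℕ) (hm : ∀ i, m ≤ h (lam i)) (j : Fin (n + 1)) :
    ∃ M' : Submodule A M, M' ≤ F j ∧ FrFilt Θ (fun nu => m < h nu) M' ∧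
      ∃ q : ∀ i : Fin n, F j →ₗ[A] Θ (lam i),
        (∀ i, ¬ (i.castSucc < j ∧ h (lam i) = m) → q i = 0) ∧
        (∀ x : F j, x.1 ∈ M' ↔ ∀ i, q i x = 0) ∧
        (∀ a : ∀ i, Θ (lam i), (∀ i, ¬ (i.castSucc < j ∧ h (lam i) = m) → a i = 0) →
          ∃ x, ∀ i, q i x = a i) := by
  induction j using Fin.induction with
  | zero =>
    refine ⟨⊥, bot_le, .bot, fun i => 0, fun _ _ => rfl, ?_, ?_⟩
    · rintro ⟨x, hx⟩
      rw [hbot] at hx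
      simpa using hx
    · intro a ha
      exact ⟨0, fun i => by simp [ha i]⟩
  | succ j ih =>
    obtain ⟨M', hle, hfilt, q, hq0, hqk, hqs⟩ := ih
    obtain ⟨p, hp, hpk⟩ := hfac j
    have hjj : F j.castSucc ≤ F j.succ := hmono (Fin.castSucc_le_succ j)
    let ι := Submodule.inclusion hjj
    have hι : ∀ t, p t = 0 ↔ ∃ x, ι x = t := by
      intro t
      rw [hpk]
      exact ⟨fun ht => ⟨⟨t.1, ht⟩, rfl⟩, by rintro ⟨x, rfl⟩; exact x.2⟩
    have hr : ∀ i, ∃ r : F j.succ →ₗ[A] Θ (lam i), (∀ x, r (ι x) = q i x) ∧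
        (¬ (i.castSucc < j.castSucc ∧ h (lam i) = m) → r = 0) := by
      intro i
      by_cases hi : i.castSucc < j.castSucc ∧ h (lam i) = m
      · obtain ⟨r, hr⟩ := fr_extend (hext (lam j) (lam i) (hi.2 ▸ hm j)) ι
          (Submodule.inclusion_injective hjj) p hp hι (q i)
        exact ⟨r, hr, fun h => absurd hi h⟩
      · exact ⟨0, fun x => by simp [hq0 i hi], fun _ => rfl⟩
    choose r hr hr0 using hr
    have key : ∀ (a : ∀ i, Θ (lam i)) (y : Θ (lam j)),
        (∀ i, ¬ (i.castSucc < j.castSucc ∧ h (lam i) = m) → a i = 0) →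
        ∃ t, p t = y ∧ ∀ i, r i t = a i := by
      intro a y ha
      obtain ⟨t, ht⟩ := hp y
      obtain ⟨x, hx⟩ := hqs (fun i => a i - r i t) (fun i hi => by simp [ha i hi, hr0 i hi])
      refine ⟨t + ι x, ?_, fun i => ?_⟩
      · rw [map_add, ht, (hι (ι x)).2 ⟨x, rfl⟩, add_zero]
      · rw [map_add, hr, hx]; abel
    have ker : ∀ t : F j.succ, t.1 ∈ M' ↔ p t = 0 ∧ ∀ i, r i t = 0 := by
      intro t
      constructor
      · intro ht
        refine ⟨(hpk t).2 (hle ht), fun i => ?_⟩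
        have := (hqk ⟨t.1, hle ht⟩).1 ht i
        rw [← hr] at this
        exact this
      · rintro ⟨h1, h2⟩
        obtain ⟨x, rfl⟩ := (hι t).1 h1
        exact (hqk x).2 (fun i => by rw [← hr, h2])
    by_cases hj : h (lam j) = m
    · refine ⟨M', hle.trans hjj, hfilt,
        fun i => r i + LinearMap.proj i ∘ₗ LinearMap.single A (fun i => Θ (lam i)) j ∘ₗ p,
        ?_, ?_, ?_⟩
      · intro i hi
        have hij : i ≠ j := by
          rintro rfl
          exact hi ⟨Fin.castSucc_lt_succ, hj⟩
        beta_reduce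
        rw [hr0 i (fun h => hi ⟨h.1.trans Fin.castSucc_lt_succ, h.2⟩)]
        ext t
        simp [Pi.single_eq_of_ne hij]
      · intro t
        rw [ker]
        constructor
        · rintro ⟨h1, h2⟩ i
          simp [h1, h2]
        · intro ht
          have h1 : p t = 0 := by
            have := ht j
            beta_reduce at this
            rw [hr0 j (by simp)] at this
            simpa using this
          refine ⟨h1, fun i => ?_⟩
          simpa [h1] using ht i
      · intro a ha
        obtain ⟨t, ht, hrt⟩ := key (fun i => if i = j then 0 else a i) (a j) (by
          intro i hi
          by_cases hij : i = j
          · simp [hij]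
          · simp only [hij, if_false]
            refine ha i (fun h => hi ⟨?_, h.2⟩)
            have h1 := h.1
            simp only [Fin.lt_def, Fin.val_castSucc, Fin.val_succ] at h1 ⊢
            have : i.1 ≠ j.1 := fun h => hij (Fin.ext h)
            omega)
        refine ⟨t, fun i => ?_⟩
        by_cases hij : i = j
        · subst hij
          simp [ht, hrt]
        · simp [ht, hrt, hij, Pi.single_eq_of_ne hij]
    · have hlt : m < h (lam j) := lt_of_le_of_ne (hm j) (Ne.symm hj)
      let K : Submodule A (F j.succ) := LinearMap.ker (LinearMap.pi r)
      have hK : ∀ t, t ∈ K ↔ ∀ i, r i t = 0 := fun t => by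
        simp [K, funext_iff]
      let M'' := K.map (F j.succ).subtype
      have hM'' : ∀ t : F j.succ, t.1 ∈ M'' ↔ ∀ i, r i t = 0 := fun t => by
        rw [← hK]; simp [M'']
      have hle'' : M'' ≤ F j.succ := Submodule.map_subtype_le _ _
      refine ⟨M'', hle'', .step M' M'' (lam j) ?_ hfilt hlt ?_, r, ?_, hM'', ?_⟩
      · intro x hx
        exact (hM'' ⟨x, hjj (hle hx)⟩).2 ((ker ⟨x, hjj (hle hx)⟩).1 hx).2
      · refine ⟨p ∘ₗ Submodule.inclusion hle'', ?_, ?_⟩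
        · intro y
          obtain ⟨t, ht, hrt⟩ := key 0 y (fun _ _ => rfl)
          exact ⟨⟨t.1, (hM'' t).2 hrt⟩, ht⟩
        · intro x
          have h1 := ker (Submodule.inclusion hle'' x)
          have h2 := (hM'' (Submodule.inclusion hle'' x)).1 x.2
          exact ⟨fun h => h1.2 ⟨h, h2⟩, fun h => (h1.1 h).1⟩
      · intro i hi
        exact hr0 i (fun h => hi ⟨h.1.trans Fin.castSucc_lt_succ, h.2⟩)
      · intro a ha
        obtain ⟨t, _, hrt⟩ := key a 0 (by
          intro i hi
          refine ha i (fun h => hi ⟨?_, h.2⟩)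
          have hij : i ≠ j := by rintro rfl; exact hj h.2
          have h1 := h.1
          simp only [Fin.lt_def, Fin.val_castSucc, Fin.val_succ] at h1 ⊢
          have : i.1 ≠ j.1 := fun h => hij (Fin.ext h)
          omega)
        exact ⟨t, hrt⟩

/-- Filtration rearrangement: if `M` is filtered by modules `Θ_λ` with
`Ext¹(Θ_λ, Θ_μ) = 0` whenever `h λ ≥ h μ`, then there is a submodule `M' ⊆ M`
filtered by the factors of non-minimal height such that `M/M'` is the direct sum of
the factors of minimal height. -/
theorem filtration_rearrangement
    (k : Type) [Field k] (A : Type) [Ring A] [Algebra k A] [FiniteDimensional k A]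
    (Λ : Type) [Fintype Λ] (h : Λ → ℕ)
    (Θ : Λ → Type) [∀ lam, AddCommGroup (Θ lam)] [∀ lam, Module A (Θ lam)]
    (hext : ∀ lam mu : Λ, h mu ≤ h lam →
      Subsingleton (ext A 1 (ModuleCat.of A (Θ lam)) (ModuleCat.of A (Θ mu))))
    (M : Type) [AddCommGroup M] [Module A M]
    (n : ℕ) (hn : 0 < n) (F : Fin (n + 1) → Submodule A M) (lam : Fin n → Λ)
    (hmono : Monotone F) (hbot : F 0 = ⊥) (htop : F (Fin.last n) = ⊤)
    (hfac : ∀ i : Fin n,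
      Nonempty ((↥(F i.succ) ⧸ (Submodule.comap (F i.succ).subtype (F i.castSucc)))
        ≃ₗ[A] Θ (lam i))) :
    ∃ M' : Submodule A M,
      HasFiltrationBy A Θ ↥M'
        (fun nu => sInf (Set.range fun i => h (lam i)) < h nu) ∧
      Nonempty ((M ⧸ M') ≃ₗ[A]
        Π i : {i : Fin n // h (lam i) = sInf (Set.range fun j => h (lam j))},
          Θ (lam i.1)) := by
  classical
  obtain ⟨M', -, hfilt, q, hq0, hqk, hqs⟩ := fr_main h Θ hext M n F lam hmono hbot
    (fun i => (frFac_iff _ _ _).2 (hfac i)) (sInf (Set.range fun i => h (lam i)))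
    (fun i => Nat.sInf_le ⟨i, rfl⟩) (Fin.last n)
  refine ⟨M', frFilt_has Θ _ M' hfilt, ?_⟩
  let e : M →ₗ[A] F (Fin.last n) := LinearMap.codRestrict _ LinearMap.id (fun x => by simp [htop])
  let f : M →ₗ[A] Π i : {i : Fin n // h (lam i) = sInf (Set.range fun j => h (lam j))},
          Θ (lam i.1) := LinearMap.pi (fun i => q i.1 ∘ₗ e)
  have hker : M' = LinearMap.ker f := by
    ext x
    rw [LinearMap.mem_ker]
    refine (hqk (e x)).trans ⟨fun hx => funext fun i => hx i.1, fun hx i => ?_⟩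
    by_cases hi : h (lam i) = sInf (Set.range fun j => h (lam j))
    · exact congrFun hx ⟨i, hi⟩
    · rw [hq0 i (fun h => hi h.2)]; rfl
  rw [hker]
  refine ⟨f.quotKerEquivOfSurjective ?_⟩
  intro a
  obtain ⟨x, hx⟩ := hqs (fun i =>
    if hi : h (lam i) = sInf (Set.range fun j => h (lam j)) then a ⟨i, hi⟩ else 0) (by
      intro i hi
      rw [dif_neg]
      exact fun h => hi ⟨Fin.castSucc_lt_last i, h⟩)
  refine ⟨x.1, funext fun i => ?_⟩
  have := hx i.1
  rw [dif_pos i.2] at this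
  exact this
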